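/- arXiv:1508.02694 — 3 statements merged into one kernel-verified Lean document; each statement's English description precedes it below -/
import Mathlib

section
/- A positive integer m is represented by the quadratic form x^2 + y^2 + 3z^2 (i.e., there exist integers x, y, z with x^2 + y^2 + 3z^2 = m) if and only if m is not of the form 9^k(9ℓ + 6) for some nonnegative integers k and ℓ. -/
open Matrix

/-- The Gram matrix of a ternary quadratic form with diagonal `a, c, k`. -/
def ternaryGram (a b c d e k : ℤ) : Matrix (Fin 3) (Fin 3) ℤ := !![a, b, d; b, c, e; d, e, k]

/-- The property of a Gram matrix that it is induced by an integral substitution from that of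
`x² + y² + 3z²` or of `x² + 2y² + 2yz + 2z²`. -/
def ReducesToDetThree (A : Matrix (Fin 3) (Fin 3) ℤ) : Prop :=
  ∃ T : Matrix (Fin 3) (Fin 3) ℤ,
    A = Tᵀ * ternaryGram 1 0 1 0 0 3 * T ∨ A = Tᵀ * ternaryGram 1 0 2 0 1 2 * T

lemma ReducesToDetThree.of_congr {A B : Matrix (Fin 3) (Fin 3) ℤ} (V : Matrix (Fin 3) (Fin 3) ℤ)
    (h : A = Vᵀ * B * V) (hB : ReducesToDetThree B) : ReducesToDetThree A := by
  obtain ⟨T, rfl | rfl⟩ := hB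
  · exact ⟨T * V, Or.inl (by rw [h, transpose_mul]; simp only [Matrix.mul_assoc])⟩
  · exact ⟨T * V, Or.inr (by rw [h, transpose_mul]; simp only [Matrix.mul_assoc])⟩

lemma reducesToDetThree_shear {a b c d e k : ℤ} (s t u : ℤ)
    (h : ReducesToDetThree (ternaryGram a (b + s * a) (c + 2 * s * b + s ^ 2 * a)
      (d + t * b + u * a) (e + t * c + u * b + s * (d + t * b + u * a))
      (k + 2 * t * e + 2 * u * d + t ^ 2 * c + 2 * t * u * b + u ^ 2 * a))) :
    ReducesToDetThree (ternaryGram a b c d e k) := by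
  refine h.of_congr !![1, -s, s * t - u; 0, 1, -t; 0, 0, 1] ?_
  ext i j
  fin_cases i <;> fin_cases j <;>
    simp [ternaryGram, Matrix.mul_apply, Fin.sum_univ_three] <;> ring

lemma reducesToDetThree_swap_left {a b c d e k : ℤ}
    (h : ReducesToDetThree (ternaryGram c b a e d k)) :
    ReducesToDetThree (ternaryGram a b c d e k) := by
  refine h.of_congr !![0, 1, 0; 1, 0, 0; 0, 0, 1] ?_
  ext i j
  fin_cases i <;> fin_cases j <;> simp [ternaryGram, Matrix.mul_apply, Fin.sum_univ_three]

lemma reducesToDetThree_swap_right {a b c d e k : ℤ}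
    (h : ReducesToDetThree (ternaryGram a d k b e c)) :
    ReducesToDetThree (ternaryGram a b c d e k) := by
  refine h.of_congr !![1, 0, 0; 0, 0, 1; 0, 1, 0] ?_
  ext i j
  fin_cases i <;> fin_cases j <;> simp [ternaryGram, Matrix.mul_apply, Fin.sum_univ_three]

lemma exists_add_mul_abs_le (q : ℤ) {p : ℤ} (hp : 0 < p) : ∃ t : ℤ, |2 * (q + t * p)| ≤ p := by
  refine ⟨-((2 * q + p) / (2 * p)), abs_le.mpr ?_⟩
  have h1 := Int.emod_add_mul_ediv (2 * q + p) (2 * p)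
  have h2 := Int.emod_nonneg (2 * q + p) (show 2 * p ≠ 0 by omega)
  have h3 := Int.emod_lt_of_pos (2 * q + p) (show 0 < 2 * p by omega)
  constructor <;> linarith

lemma four_mul_sq_le_of_abs_two_mul_le {b a : ℤ} (h : |2 * b| ≤ a) : 4 * b ^ 2 ≤ a ^ 2 := by
  have := sq_le_sq' (abs_le.mp h).1 (abs_le.mp h).2
  linarith

lemma reducesToDetThree_of_reduced {a b c d e k : ℤ} (ha : 0 < a) (hp : 0 < a * c - b ^ 2)
    (hdet : (a * c - b ^ 2) * (a * k - d ^ 2) - (a * e - b * d) ^ 2 = 3 * a)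
    (hb : |2 * b| ≤ a) (hd : |2 * d| ≤ a) (hq : |2 * (a * e - b * d)| ≤ a * c - b ^ 2)
    (hac : a ≤ c) (hpr : a * c - b ^ 2 ≤ a * k - d ^ 2) :
    ReducesToDetThree (ternaryGram a b c d e k) := by
  have hb2 := four_mul_sq_le_of_abs_two_mul_le hb
  have hq2 := four_mul_sq_le_of_abs_two_mul_le hq
  have ha1 : a = 1 := by
    generalize a * k - d ^ 2 = r at *
    generalize a * e - b * d = q at *
    have h1 : 3 * a ^ 2 ≤ 4 * (a * c - b ^ 2) := by nlinarith
    generalize a * c - b ^ 2 = p at *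
    have h2 : p ^ 2 ≤ 4 * a := by nlinarith
    by_contra hne
    have h3 : 2 ≤ a := by omega
    have h4 : 6 * a ≤ 4 * p := by nlinarith
    nlinarith
  subst ha1
  have hb0 : b = 0 := by have := abs_le.mp hb; omega
  have hd0 : d = 0 := by have := abs_le.mp hd; omega
  subst hb0 hd0
  simp only [one_mul, zero_mul, mul_one, sub_zero, ne_eq, OfNat.ofNat_ne_zero, not_false_eq_true,
    zero_pow] at *
  have hc2 : c ≤ 2 := by nlinarith
  have hq' := abs_le.mp hq
  have hc : c = 1 ∨ c = 2 := by omega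
  have he : e = 0 ∨ e = 1 ∨ e = -1 := by omega
  rcases hc with rfl | rfl <;> rcases he with rfl | rfl | rfl <;> try omega
  · obtain rfl : k = 3 := by omega
    exact ⟨1, Or.inl (by simp)⟩
  · obtain rfl : k = 2 := by omega
    exact ⟨1, Or.inr (by simp)⟩
  · obtain rfl : k = 2 := by omega
    refine ReducesToDetThree.of_congr !![1, 0, 0; 0, 1, 0; 0, 0, -1] ?_ ⟨1, Or.inr rfl⟩
    ext i j
    fin_cases i <;> fin_cases j <;> simp [ternaryGram, Matrix.mul_apply, Fin.sum_univ_three]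

/-- The determinant condition is multiplied by `a` and written through the binary form obtained by
completing the square. -/
theorem reducesToDetThree_of_det_eq_three {a b c d e k : ℤ} (ha : 0 < a) (hp : 0 < a * c - b ^ 2)
    (hdet : (a * c - b ^ 2) * (a * k - d ^ 2) - (a * e - b * d) ^ 2 = 3 * a) :
    ReducesToDetThree (ternaryGram a b c d e k) := by
  obtain ⟨n, hn⟩ : ∃ n : ℕ, a.toNat = n := ⟨_, rfl⟩
  induction n using Nat.strong_induction_on generalizing a b c d e k with
  | _ n iha =>
  obtain ⟨l, hl⟩ : ∃ l : ℕ, (a * c - b ^ 2).toNat = l := ⟨_, rfl⟩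
  induction l using Nat.strong_induction_on generalizing b c d e k with
  | _ l ihp =>
  obtain ⟨t, ht⟩ := exists_add_mul_abs_le (a * e - b * d) hp
  obtain ⟨s, hs⟩ := exists_add_mul_abs_le b ha
  obtain ⟨u, hu⟩ := exists_add_mul_abs_le (d + t * b) ha
  refine reducesToDetThree_shear s t u ?_
  have hp' : a * (c + 2 * s * b + s ^ 2 * a) - (b + s * a) ^ 2 = a * c - b ^ 2 := by ring
  have hq' : a * (e + t * c + u * b + s * (d + t * b + u * a)) - (b + s * a) * (d + t * b + u * a)
      = a * e - b * d + t * (a * c - b ^ 2) := by ring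
  have hdet' : (a * (c + 2 * s * b + s ^ 2 * a) - (b + s * a) ^ 2) *
      (a * (k + 2 * t * e + 2 * u * d + t ^ 2 * c + 2 * t * u * b + u ^ 2 * a) -
        (d + t * b + u * a) ^ 2) -
      (a * (e + t * c + u * b + s * (d + t * b + u * a)) -
        (b + s * a) * (d + t * b + u * a)) ^ 2 = 3 * a := by
    rw [← hdet]; ring
  rw [← hq', ← hp'] at ht
  rw [← hp'] at hp hl
  generalize b + s * a = b', c + 2 * s * b + s ^ 2 * a = c', d + t * b + u * a = d',
    e + t * c + u * b + s * (d + t * b + u * a) = e',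
    k + 2 * t * e + 2 * u * d + t ^ 2 * c + 2 * t * u * b + u ^ 2 * a = k' at *
  by_cases hac : a ≤ c'
  swap
  · have hc : 0 < c' := by nlinarith [sq_nonneg b']
    apply reducesToDetThree_swap_left
    refine iha c'.toNat (by omega) hc (by linarith) ?_ rfl
    apply mul_left_cancel₀ ha.ne'
    linear_combination c' * hdet'
  by_cases hpr : a * c' - b' ^ 2 ≤ a * k' - d' ^ 2
  swap
  · have hr : 0 < a * k' - d' ^ 2 := by nlinarith [sq_nonneg (a * e' - b' * d')]
    apply reducesToDetThree_swap_right
    refine ihp (a * k' - d' ^ 2).toNat (by omega) hr ?_ rfl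
    rw [← hdet']; ring
  exact reducesToDetThree_of_reduced ha hp hdet' hs hu ht hac hpr

/-- A positive definite ternary form of determinant `3` whose leading `2 × 2` minor is `≡ 1`
mod `3` is induced from `x² + y² + 3z²`, so its last diagonal entry is represented by that form. -/
theorem exists_rep_of_gram {a b c d e m : ℤ} (ha : 0 < a) (hp : 0 < a * c - b ^ 2)
    (hdet : (a * c - b ^ 2) * (a * m - d ^ 2) - (a * e - b * d) ^ 2 = 3 * a)
    (h3 : (a * c - b ^ 2) % 3 = 1) : ∃ x y z : ℤ, x ^ 2 + y ^ 2 + 3 * z ^ 2 = m := by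
  obtain ⟨T, hT | hT⟩ := reducesToDetThree_of_det_eq_three ha hp hdet
  · have h := congrFun (congrFun hT 2) 2
    simp only [ternaryGram, Matrix.mul_apply, Fin.sum_univ_three] at h
    simp at h
    exact ⟨T 0 2, T 1 2, T 2 2, by linarith⟩
  · exfalso
    have h00 := congrFun (congrFun hT 0) 0
    have h01 := congrFun (congrFun hT 0) 1
    have h11 := congrFun (congrFun hT 1) 1
    simp only [ternaryGram, Matrix.mul_apply, Fin.sum_univ_three] at h00 h01 h11
    simp at h00 h01 h11
    obtain ⟨w₁, hw₁⟩ : ∃ w, w = T 0 0 * T 1 1 - T 0 1 * T 1 0 := ⟨_, rfl⟩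
    obtain ⟨w₂, hw₂⟩ : ∃ w, w = T 0 0 * T 2 1 - T 0 1 * T 2 0 := ⟨_, rfl⟩
    obtain ⟨w₃, hw₃⟩ : ∃ w, w = T 1 0 * T 2 1 - T 1 1 * T 2 0 := ⟨_, rfl⟩
    have key : a * c - b ^ 2 = 2 * (w₁ - w₂) ^ 2 + 3 * (2 * w₁ * w₂ + w₃ ^ 2) := by
      rw [h00, h01, h11, hw₁, hw₂, hw₃]; ring
    rw [key] at h3
    have : (w₁ - w₂) % 3 = 0 ∨ (w₁ - w₂) % 3 = 1 ∨ (w₁ - w₂) % 3 = 2 := by omega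
    rcases this with h | h | h <;>
      simp [pow_two, Int.add_emod, Int.mul_emod, h] at h3

lemma exists_rep_of_dvd_sq_add {m s b r x : ℤ} (hb : 0 < b) (hr : 0 < r) (hb3 : b % 3 = 1)
    (hm : m * b = s ^ 2 * r + 3) (hx : r ∣ x ^ 2 + b) :
    ∃ x y z : ℤ, x ^ 2 + y ^ 2 + 3 * z ^ 2 = m := by
  obtain ⟨w, hw⟩ := hx
  have hw' : w * r - x ^ 2 = b := by linarith
  have hw0 : 0 < w := by
    refine pos_of_mul_pos_right (?_ : 0 < r * w) hr.le
    rw [← hw]; positivity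
  refine exists_rep_of_gram (a := w) (b := x) (c := r) (d := s) (e := 0) hw0 ?_ ?_ ?_
  · rwa [hw']
  · rw [hw']
    linear_combination w * hm - s ^ 2 * hw
  · rwa [hw']

open NumberTheorySymbols

lemma jacobiSym_neg_three_of_mod_twelve_eq_seven {b : ℕ} (hb : b % 12 = 7) : J(-3 | b) = 1 := by
  have hodd : Odd b := Nat.odd_iff.mpr (by omega)
  rw [jacobiSym.neg _ hodd, ZMod.χ₄_nat_three_mod_four (by omega)]
  have h := jacobiSym.quadratic_reciprocity_three_mod_four (a := 3) (b := b) rfl (by omega)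
  rw [jacobiSym.mod_left (b : ℤ), show (b : ℤ) % (3 : ℕ) = 1 by omega, jacobiSym.one_left] at h
  push_cast at h
  rw [h]; rfl

lemma jacobiSym_neg_three_of_mod_twelve_eq_five {b : ℕ} (hb : b % 12 = 5) : J(-3 | b) = -1 := by
  have hodd : Odd b := Nat.odd_iff.mpr (by omega)
  rw [jacobiSym.neg _ hodd, ZMod.χ₄_nat_one_mod_four (by omega)]
  have h := jacobiSym.quadratic_reciprocity_one_mod_four' (a := 3) (b := b) (by decide) (by omega)
  rw [jacobiSym.mod_left (b : ℤ), show (b : ℤ) % (3 : ℕ) = 2 by omega] at h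
  push_cast at h
  rw [h]; norm_num

lemma jacobiSym_eq_neg_three {m s b u p : ℕ} (hs : s.Coprime b) (hu : J(u | b) = 1)
    (hm : m * b = s ^ 2 * (u * p) + 3) : J(p | b) = J(-3 | b) := by
  have h1 : J((s ^ 2 * (u * p) : ℕ) | b) = J(-3 | b) := by
    apply jacobiSym.mod_left'
    apply Int.ModEq.symm
    rw [Int.modEq_iff_dvd]
    exact ⟨m, by push_cast; zify at hm; linarith⟩
  rw [← h1]
  push_cast
  rw [jacobiSym.mul_left, jacobiSym.mul_left, jacobiSym.sq_one' (by simpa using hs), hu]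
  ring

lemma exists_dvd_sq_add_of_jacobiSym {p b : ℕ} (hp : p.Prime) (h : J(-b | p) = 1) :
    ∃ x : ℤ, (p : ℤ) ∣ x ^ 2 + b := by
  have := Fact.mk hp
  obtain ⟨y, hy⟩ := ZMod.isSquare_of_jacobiSym_eq_one h
  obtain ⟨x, rfl⟩ := ZMod.intCast_surjective y
  refine ⟨x, ?_⟩
  rw [← ZMod.intCast_zmod_eq_zero_iff_dvd]
  push_cast at hy ⊢
  rw [pow_two, ← hy]; ring

lemma exists_two_mul_dvd_sq_add {p b : ℤ} (hp : p % 2 = 1) {x : ℤ} (hx : p ∣ x ^ 2 + b) :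
    ∃ y : ℤ, 2 * p ∣ y ^ 2 + b := by
  have hcop : IsCoprime (2 : ℤ) p := ⟨-(p / 2), 1, by omega⟩
  have hpar : ∀ y : ℤ, p ∣ y ^ 2 + b → (y + b) % 2 = 0 → 2 * p ∣ y ^ 2 + b := by
    refine fun y hy hyb => hcop.mul_dvd ?_ hy
    have h : (2 : ℤ) ∣ y * (y - 1) := by
      simpa using (Int.even_mul_pred_self y).two_dvd
    have : y ^ 2 + b = y * (y - 1) + (y + b) := by ring
    rw [this]
    exact dvd_add h (Int.dvd_of_emod_eq_zero hyb)
  rcases Int.emod_two_eq_zero_or_one (x + b) with h | h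
  · exact ⟨x, hpar x hx h⟩
  · refine ⟨x + p, hpar _ ?_ (by omega)⟩
    have : (x + p) ^ 2 + b = x ^ 2 + b + p * (2 * x + p) := by ring
    rw [this]
    exact dvd_add hx (dvd_mul_right _ _)

lemma jacobiSym_neg_of_mod_twelve_eq_seven {m s b u p : ℕ} (hp : p % 2 = 1) (hb : b % 12 = 7)
    (hs : s.Coprime b) (hu : J(u | b) = 1) (hm : m * b = s ^ 2 * (u * p) + 3) :
    J(-b | p) = 1 := by
  have h := jacobiSym_eq_neg_three hs hu hm
  rw [jacobiSym_neg_three_of_mod_twelve_eq_seven hb] at h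
  have hbodd : Odd b := Nat.odd_iff.mpr (by omega)
  rw [jacobiSym.neg _ (Nat.odd_iff.mpr hp)]
  rcases (by omega : p % 4 = 1 ∨ p % 4 = 3) with h4 | h4
  · rw [ZMod.χ₄_nat_one_mod_four h4, jacobiSym.quadratic_reciprocity_one_mod_four' hbodd h4, h]
    rfl
  · rw [ZMod.χ₄_nat_three_mod_four h4,
      jacobiSym.quadratic_reciprocity_three_mod_four (by omega) h4, h]
    rfl

lemma exists_rep_of_prime {m s b p : ℕ} (hp : p.Prime) (hp2 : 2 < p) (hb : b % 12 = 7)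
    (hs : s.Coprime b) (hm : m * b = s ^ 2 * p + 3) :
    ∃ x y z : ℤ, x ^ 2 + y ^ 2 + 3 * z ^ 2 = m := by
  have hodd : p % 2 = 1 := hp.eq_two_or_odd.resolve_left (by omega)
  obtain ⟨x, hx⟩ := exists_dvd_sq_add_of_jacobiSym hp
    (jacobiSym_neg_of_mod_twelve_eq_seven (u := 1) hodd hb hs (by simp) (by rw [hm]; ring))
  exact exists_rep_of_dvd_sq_add (s := s) (r := p) (by omega) (by omega) (by omega)
    (by exact_mod_cast hm) hx

lemma exists_rep_of_two_mul_prime {m s b p : ℕ} (hp : p.Prime) (hp2 : 2 < p) (hb : b % 24 = 7)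
    (hs : s.Coprime b) (hm : m * b = s ^ 2 * (2 * p) + 3) :
    ∃ x y z : ℤ, x ^ 2 + y ^ 2 + 3 * z ^ 2 = m := by
  have hodd : p % 2 = 1 := hp.eq_two_or_odd.resolve_left (by omega)
  have h2 : J((2 : ℕ) | b) = 1 := by
    push_cast
    rw [jacobiSym.at_two (Nat.odd_iff.mpr (by omega)), ZMod.χ₈_nat_mod_eight,
      show b % 8 = 7 by omega]
    rfl
  obtain ⟨x, hx⟩ := exists_dvd_sq_add_of_jacobiSym hp
    (jacobiSym_neg_of_mod_twelve_eq_seven hodd (by omega) hs h2 hm)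
  obtain ⟨y, hy⟩ := exists_two_mul_dvd_sq_add (by omega) hx
  exact exists_rep_of_dvd_sq_add (s := s) (r := 2 * p) (by omega) (by omega) (by omega)
    (by exact_mod_cast hm) hy

lemma exists_rep_of_prime_mod_eight_eq_seven {m s b p : ℕ} (hp : p.Prime) (hp8 : p % 8 = 7)
    (hb : b % 12 = 5) (hs : s.Coprime b) (hm : m * (2 * b) = s ^ 2 * p + 3) :
    ∃ x y z : ℤ, x ^ 2 + y ^ 2 + 3 * z ^ 2 = m := by
  have h := jacobiSym_eq_neg_three (m := 2 * m) (u := 1) (p := p) hs (by simp) (by linarith)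
  rw [jacobiSym_neg_three_of_mod_twelve_eq_five hb] at h
  have hpodd : Odd p := Nat.odd_iff.mpr (by omega)
  have hJ : J(-(2 * b : ℕ) | p) = 1 := by
    push_cast
    rw [← neg_mul, jacobiSym.mul_left, jacobiSym.at_neg_two hpodd,
      (ZMod.natCast_eq_natCast_iff' p 7 8).mpr hp8,
      jacobiSym.quadratic_reciprocity_one_mod_four (by omega) hpodd, h]
    rfl
  obtain ⟨x, hx⟩ := exists_dvd_sq_add_of_jacobiSym hp hJ
  exact exists_rep_of_dvd_sq_add (s := s) (r := p) (b := (2 * b : ℕ)) (by omega) (by omega)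
    (by omega) (by exact_mod_cast hm) hx

lemma exists_prime_eq_two_pow_mul_add {a m c u w : ℕ} (i : ℕ) (hm : m ≠ 0) (ha : a % 2 = 1)
    (h : c * m = u * a + w) (hw : a.Coprime w) :
    ∃ p t : ℕ, p.Prime ∧ 2 < p ∧ p = 2 ^ i * m * t + a := by
  have ham : a.Coprime m := by
    refine Nat.Coprime.coprime_dvd_right (Dvd.intro_left c h) ?_
    rwa [add_comm, Nat.coprime_add_mul_right_right]
  have hcop : a.Coprime (2 ^ i * m) :=
    ((Nat.coprime_two_right.mpr (Nat.odd_iff.mpr ha)).pow_right i).mul_right ham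
  obtain ⟨p, hpa, hp, hmod⟩ :=
    Nat.forall_exists_prime_gt_and_modEq (a + 2) (by positivity : 2 ^ i * m ≠ 0) hcop
  obtain ⟨t, ht⟩ := (Nat.modEq_iff_dvd' (by omega)).mp hmod.symm
  exact ⟨p, t, hp, by omega, by omega⟩

lemma exists_rep_of_not_three_dvd {m : ℕ} (hm : m % 3 ≠ 0) :
    ∃ x y z : ℤ, x ^ 2 + y ^ 2 + 3 * z ^ 2 = m := by
  have hcop : ∀ a : ℕ, a % 3 ≠ 0 → a.Coprime 9 := fun a ha =>
    Nat.Coprime.pow_right 2 (((Nat.prime_three.coprime_iff_not_dvd).mpr (by omega)).symm)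
  rcases (by omega : m % 2 = 0 ∨ m % 4 = 3 ∨ m % 4 = 1) with h | h | h
  · obtain ⟨p, t, hp, hp2, ht⟩ := exists_prime_eq_two_pow_mul_add (a := 7 * m - 3) (m := 3 * m)
      (c := 7) (u := 3) (w := 9) 2 (by omega) (by omega) (by omega) (hcop _ (by omega))
    refine exists_rep_of_prime (s := 1) (b := 12 * t + 7) hp hp2 (by omega) (by simp) ?_
    zify [show 3 ≤ 7 * m by omega] at ht ⊢
    rw [ht]; ring
  · obtain ⟨a, ha⟩ : ∃ a, 2 * a + 3 = 7 * m := ⟨(7 * m - 3) / 2, by omega⟩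
    obtain ⟨p, t, hp, hp2, ht⟩ := exists_prime_eq_two_pow_mul_add (a := a) (m := 3 * m)
      (c := 7) (u := 6) (w := 9) 2 (by omega) (by omega) (by omega) (hcop _ (by omega))
    refine exists_rep_of_two_mul_prime (s := 1) (b := 24 * t + 7) hp hp2 (by omega) (by simp) ?_
    rw [ht]; linarith
  · obtain ⟨p, t, hp, hp2, ht⟩ := exists_prime_eq_two_pow_mul_add (a := 10 * m - 3) (m := 3 * m)
      (c := 10) (u := 3) (w := 9) 3 (by omega) (by omega) (by omega) (hcop _ (by omega))
    refine exists_rep_of_prime_mod_eight_eq_seven (s := 1) (b := 12 * t + 5) hp ?_ (by omega)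
      (by simp) ?_
    · rw [show 2 ^ 3 * (3 * m) * t = 8 * (3 * m * t) by ring] at ht
      omega
    · zify [show 3 ≤ 10 * m by omega] at ht ⊢
      rw [ht]; ring

lemma exists_rep_three_mul {n : ℕ} (hn : n % 3 = 1) :
    ∃ x y z : ℤ, x ^ 2 + y ^ 2 + 3 * z ^ 2 = (3 * n : ℕ) := by
  have hcop : ∀ b : ℕ, b % 3 ≠ 0 → Nat.Coprime 3 b := fun b hb =>
    (Nat.prime_three.coprime_iff_not_dvd).mpr (by omega)
  rcases (by omega : n % 2 = 0 ∨ n % 4 = 1 ∨ n % 4 = 3) with h | h | h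
  · obtain ⟨a, ha⟩ : ∃ a, 3 * a + 1 = 7 * n := ⟨(7 * n - 1) / 3, by omega⟩
    obtain ⟨p, t, hp, hp2, ht⟩ := exists_prime_eq_two_pow_mul_add (a := a) (m := n)
      (c := 7) (u := 3) (w := 1) 2 (by omega) (by omega) (by omega) (by simp)
    refine exists_rep_of_prime (s := 3) (b := 12 * t + 7) hp hp2 (by omega)
      (hcop _ (by omega)) ?_
    rw [ht]; linarith
  · obtain ⟨a, ha⟩ : ∃ a, 6 * a + 1 = 7 * n := ⟨(7 * n - 1) / 6, by omega⟩
    obtain ⟨p, t, hp, hp2, ht⟩ := exists_prime_eq_two_pow_mul_add (a := a) (m := n)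
      (c := 7) (u := 6) (w := 1) 2 (by omega) (by omega) (by omega) (by simp)
    refine exists_rep_of_two_mul_prime (s := 3) (b := 24 * t + 7) hp hp2 (by omega)
      (hcop _ (by omega)) ?_
    rw [ht]; linarith
  · obtain ⟨a, ha⟩ : ∃ a, 3 * a + 1 = 10 * n := ⟨(10 * n - 1) / 3, by omega⟩
    obtain ⟨p, t, hp, hp2, ht⟩ := exists_prime_eq_two_pow_mul_add (a := a) (m := n)
      (c := 10) (u := 3) (w := 1) 3 (by omega) (by omega) (by omega) (by simp)
    refine exists_rep_of_prime_mod_eight_eq_seven (s := 3) (b := 12 * t + 5) hp ?_ (by omega)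
      (hcop _ (by omega)) ?_
    · rw [show 2 ^ 3 * n * t = 8 * (n * t) by ring] at ht
      omega
    · rw [ht]; linarith

lemma exists_rep_of_forall_ne {m : ℕ} (hm : 0 < m)
    (h : ∀ k l : ℕ, m ≠ 9 ^ k * (9 * l + 6)) : ∃ x y z : ℤ, x ^ 2 + y ^ 2 + 3 * z ^ 2 = m := by
  induction m using Nat.strong_induction_on with
  | _ m ih =>
  by_cases h3 : m % 3 = 0
  swap
  · exact exists_rep_of_not_three_dvd h3
  obtain ⟨n, rfl⟩ : ∃ n, m = 3 * n := ⟨m / 3, by omega⟩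
  rcases (by omega : n % 3 = 0 ∨ n % 3 = 1 ∨ n % 3 = 2) with hn | hn | hn
  · obtain ⟨j, rfl⟩ : ∃ j, n = 3 * j := ⟨n / 3, by omega⟩
    obtain ⟨x, y, z, hxyz⟩ := ih j (by omega) (by omega) fun k l hkl =>
      h (k + 1) l (by rw [hkl]; ring)
    exact ⟨3 * x, 3 * y, 3 * z, by push_cast; rw [← hxyz]; ring⟩
  · exact exists_rep_three_mul hn
  · exact absurd (show 3 * n = 9 ^ 0 * (9 * (n / 3) + 6) by omega) (h _ _)

lemma three_dvd_of_three_dvd_sq_add_sq {x y : ℤ} (h : 3 ∣ x ^ 2 + y ^ 2) : 3 ∣ x ∧ 3 ∣ y := by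
  have hx : x % 3 = 0 ∨ x % 3 = 1 ∨ x % 3 = 2 := by omega
  have hy : y % 3 = 0 ∨ y % 3 = 1 ∨ y % 3 = 2 := by omega
  simp only [Int.dvd_iff_emod_eq_zero] at *
  rcases hx with hx | hx | hx <;> rcases hy with hy | hy | hy <;>
    simp_all [pow_two, Int.add_emod, Int.mul_emod]

lemma sq_add_sq_add_three_mul_sq_ne (k l : ℕ) (x y z : ℤ) :
    x ^ 2 + y ^ 2 + 3 * z ^ 2 ≠ 9 ^ k * (9 * l + 6) := by
  induction k generalizing x y z with
  | zero =>
    intro h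
    obtain ⟨⟨u, rfl⟩, v, rfl⟩ := three_dvd_of_three_dvd_sq_add_sq (x := x) (y := y) (by omega)
    ring_nf at h
    have hz : z % 3 = 0 ∨ z % 3 = 1 ∨ z % 3 = 2 := by omega
    have h2 : z ^ 2 % 3 = 2 := by omega
    rcases hz with hz | hz | hz <;> simp [pow_two, Int.mul_emod, hz] at h2
  | succ k ih =>
    intro h
    rw [pow_succ (9 : ℤ)] at h
    obtain ⟨⟨u, rfl⟩, v, rfl⟩ := three_dvd_of_three_dvd_sq_add_sq (x := x) (y := y)
      ⟨3 * (9 ^ k * (9 * l + 6)) - z ^ 2, by linarith⟩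
    obtain ⟨w, rfl⟩ : (3 : ℤ) ∣ z := by
      refine Int.prime_three.dvd_of_dvd_pow (n := 2) ?_
      exact ⟨9 ^ k * (9 * l + 6) - u ^ 2 - v ^ 2, by linarith⟩
    exact ih u v w (by linarith)

theorem rep_x2_y2_3z2 (m : ℤ) (hm : 0 < m) :
    (∃ x y z : ℤ, x ^ 2 + y ^ 2 + 3 * z ^ 2 = m) ↔
      ¬ ∃ k l : ℕ, m = 9 ^ k * (9 * l + 6) := by
  constructor
  · rintro ⟨x, y, z, rfl⟩ ⟨k, l, h⟩
    exact sq_add_sq_add_three_mul_sq_ne k l x y z h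
  · intro h
    lift m to ℕ using hm.le
    exact exists_rep_of_forall_ne (by omega) fun k l hkl => h ⟨k, l, by rw [hkl]; push_cast; rfl⟩
end

section
/- A positive integer m is represented by the quadratic form x^2 + 2y^2 + 3z^2 (i.e., there exist integers x, y, z with x^2 + 2y^2 + 3z^2 = m) if and only if m is not of the form 4^k(16ℓ + 10) for some nonnegative integers k and ℓ. -/
/-- Gauss reduction: the leading coefficient of a positive binary form of determinant `D`
can be made at most `√(4D/3)`. -/
theorem exists_binary_reduction (A B C : ℤ) (hA : 0 < A) (hD : 0 < A * C - B ^ 2) :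
    ∃ p q r s : ℤ, p * s - q * r = 1 ∧ 0 < A * p ^ 2 + 2 * B * p * r + C * r ^ 2 ∧
      3 * (A * p ^ 2 + 2 * B * p * r + C * r ^ 2) ^ 2 ≤ 4 * (A * C - B ^ 2) := by
  induction hn : A.toNat using Nat.strong_induction_on generalizing A B C with
  | _ n ih =>
    subst hn
    obtain ⟨k, hk₁, hk₂⟩ : ∃ k : ℤ, 2 * (B + A * k) ≤ A ∧ -A ≤ 2 * (B + A * k) := by
      have h₁ := Int.emod_add_mul_ediv (2 * B + A) (2 * A)
      have h₂ := Int.emod_nonneg (2 * B + A) (b := 2 * A) (by omega)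
      have h₃ := Int.emod_lt_of_pos (2 * B + A) (b := 2 * A) (by omega)
      exact ⟨-((2 * B + A) / (2 * A)), by linarith, by linarith⟩
    set B' := B + A * k with hB'
    set C' := C + 2 * B * k + A * k ^ 2 with hC'
    have hdet : A * C' - B' ^ 2 = A * C - B ^ 2 := by rw [hB', hC']; ring
    by_cases hlt : C' < A
    · have hC'pos : 0 < C' := by nlinarith [sq_nonneg B']
      obtain ⟨p, q, r, s, h₁, h₂, h₃⟩ :=
        ih C'.toNat (by omega) C' (-B') A hC'pos (by linarith) rfl
      refine ⟨k * p - r, k * q - s, p, q, by linarith, ?_, ?_⟩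
      · convert h₂ using 1; rw [hB', hC']; ring
      · convert h₃ using 1
        · rw [hB', hC']; ring
        · linarith
    · refine ⟨1, 0, 0, 1, by ring, by linarith, ?_⟩
      have : 4 * B' ^ 2 ≤ A ^ 2 := by nlinarith
      nlinarith

theorem binary_det_one_sum_two_sq (A B C : ℤ) (hA : 0 < A) (hD : A * C - B ^ 2 = 1) (y z : ℤ) :
    ∃ v w : ℤ, A * y ^ 2 + 2 * B * y * z + C * z ^ 2 = v ^ 2 + w ^ 2 := by
  obtain ⟨p, q, r, s, h₁, h₂, h₃⟩ := exists_binary_reduction A B C hA (by omega)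
  have h₄ : A * p ^ 2 + 2 * B * p * r + C * r ^ 2 = 1 := by nlinarith
  set E := A * p * q + B * (p * s + q * r) + C * r * s with hE
  have h₅ : A * q ^ 2 + 2 * B * q * s + C * s ^ 2 = 1 + E ^ 2 := by
    have : (A * p ^ 2 + 2 * B * p * r + C * r ^ 2) * (A * q ^ 2 + 2 * B * q * s + C * s ^ 2)
        - E ^ 2 = (A * C - B ^ 2) * (p * s - q * r) ^ 2 := by rw [hE]; ring
    rw [h₄, hD, h₁] at this
    linarith
  have hy : y = p * (s * y - q * z) + q * (p * z - r * y) := by linear_combination -y * h₁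
  have hz : z = r * (s * y - q * z) + s * (p * z - r * y) := by linear_combination -z * h₁
  generalize s * y - q * z = Y at hy hz
  generalize p * z - r * y = Z at hy hz
  refine ⟨Y + E * Z, Z, ?_⟩
  rw [hy, hz]
  linear_combination Y ^ 2 * h₄ + Z ^ 2 * h₅ - 2 * Y * Z * hE

theorem lt_of_reduction_bounds {a b d : ℤ} (ha : 2 ≤ a) (hd : 4 * d ^ 2 ≤ a ^ 2)
    (h : 3 * (a * b - d ^ 2) ^ 2 ≤ 4 * a) : b < a := by
  by_contra! hle
  have h₁ : a * a ≤ a * b := mul_le_mul_of_nonneg_left hle (by omega)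
  have h₂ : 2 * a ≤ a * a := mul_le_mul_of_nonneg_right ha (by omega)
  have h₃ : 3 * a ≤ 2 * (a * b - d ^ 2) := by linarith
  nlinarith [mul_le_mul h₃ h₃ (by omega) (by omega)]

theorem ternary_det_one_sum_three_sq (a b c d e f : ℤ) (ha : 0 < a) (hab : 0 < a * b - d ^ 2)
    (hdet : a * b * c + 2 * d * e * f - a * f ^ 2 - b * e ^ 2 - c * d ^ 2 = 1) (x y z : ℤ) :
    ∃ u v w : ℤ, a * x ^ 2 + b * y ^ 2 + c * z ^ 2 + 2 * d * x * y + 2 * e * x * z +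
      2 * f * y * z = u ^ 2 + v ^ 2 + w ^ 2 := by
  induction hn : a.toNat using Nat.strong_induction_on generalizing a b c d e f x y z with
  | _ n ih =>
    subst hn
    have hdet' : (a * b - d ^ 2) * (a * c - e ^ 2) - (a * f - d * e) ^ 2 = a := by
      linear_combination a * hdet
    obtain rfl | ha₂ : a = 1 ∨ 2 ≤ a := by omega
    · obtain ⟨v, w, h⟩ := binary_det_one_sum_two_sq _ _ _ hab hdet' y z
      exact ⟨x + d * y + e * z, v, w, by linear_combination h⟩
    obtain ⟨p, q, r, s, h₁, h₂, h₃⟩ :=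
      exists_binary_reduction _ _ _ hab (hdet'.symm ▸ ha)
    rw [hdet'] at h₃
    obtain ⟨k, hk₁, hk₂⟩ : ∃ k : ℤ, 2 * (d * p + e * r + a * k) ≤ a ∧
        -a ≤ 2 * (d * p + e * r + a * k) := by
      have h₁ := Int.emod_add_mul_ediv (2 * (d * p + e * r) + a) (2 * a)
      have h₂ := Int.emod_nonneg (2 * (d * p + e * r) + a) (b := 2 * a) (by omega)
      have h₃ := Int.emod_lt_of_pos (2 * (d * p + e * r) + a) (b := 2 * a) (by omega)
      exact ⟨-((2 * (d * p + e * r) + a) / (2 * a)), by linarith, by linarith⟩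
    set d' := d * p + e * r + a * k with hd'
    set e' := d * q + e * s with he'
    set b' := b * p ^ 2 + 2 * f * p * r + c * r ^ 2 + 2 * (d * p + e * r) * k + a * k ^ 2 with hb'
    set c' := b * q ^ 2 + 2 * f * q * s + c * s ^ 2 with hc'
    set f' := b * p * q + f * (p * s + q * r) + c * r * s + k * e' with hf'
    have hA : (a * b - d ^ 2) * p ^ 2 + 2 * (a * f - d * e) * p * r + (a * c - e ^ 2) * r ^ 2
        = a * b' - d' ^ 2 := by rw [hb', hd']; ring
    rw [hA] at h₂ h₃
    have hdet'' : b' * a * c' + 2 * d' * f' * e' - b' * e' ^ 2 - a * f' ^ 2 - c' * d' ^ 2 = 1 := by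
      have : b' * a * c' + 2 * d' * f' * e' - b' * e' ^ 2 - a * f' ^ 2 - c' * d' ^ 2 =
        (a * b * c + 2 * d * e * f - a * f ^ 2 - b * e ^ 2 - c * d ^ 2) * (p * s - q * r) ^ 2 := by
        rw [hf', hb', hd', hc', he']; ring
      rw [this, hdet, h₁]; norm_num
    have hdsq : 4 * d' ^ 2 ≤ a ^ 2 := by nlinarith
    have hb'pos : 0 < b' :=
      pos_of_mul_pos_right (h₂.trans_le (sub_le_self _ (sq_nonneg d'))) ha.le
    have hlt : b' < a := lt_of_reduction_bounds ha₂ hdsq h₃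
    obtain ⟨u, v, w, h⟩ := ih b'.toNat (by omega) b' a c' d' f' e' hb'pos (by linarith) hdet''
      (s * y - q * z) (x - k * (s * y - q * z)) (p * z - r * y) rfl
    refine ⟨u, v, w, h ▸ ?_⟩
    have hy : y = p * (s * y - q * z) + q * (p * z - r * y) := by linear_combination -y * h₁
    have hz : z = r * (s * y - q * z) + s * (p * z - r * y) := by linear_combination -z * h₁
    generalize s * y - q * z = Y at hy hz
    generalize p * z - r * y = Z at hy hz
    rw [hy, hz, hf', hb', hd', hc', he']
    ring

theorem sum_three_sq_of_dvd_sq_add (n d t : ℤ) (hn : 2 ≤ n) (hd : 0 < d)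
    (h : d * n - 1 ∣ t ^ 2 + d) : ∃ u v w : ℤ, n = u ^ 2 + v ^ 2 + w ^ 2 := by
  obtain ⟨a, ha⟩ := h
  have hpos : 0 < d * n - 1 := by nlinarith
  have hapos : 0 < a := by nlinarith [sq_nonneg t]
  obtain ⟨u, v, w, h⟩ := ternary_det_one_sum_three_sq a (d * n - 1) n t 1 0 hapos
    (by linarith) (by linear_combination -n * ha) 0 0 1
  exact ⟨u, v, w, by linarith⟩

theorem exists_dvd_sq_add_of_jacobiSym_eq_one {p : ℕ} (hp : p.Prime) {d : ℤ}
    (h : jacobiSym (-d) p = 1) : ∃ t : ℤ, (p : ℤ) ∣ t ^ 2 + d := by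
  have := Fact.mk hp
  obtain ⟨t, ht⟩ := ZMod.isSquare_of_jacobiSym_eq_one h
  obtain ⟨t, rfl⟩ := ZMod.intCast_surjective t
  refine ⟨t, (ZMod.intCast_zmod_eq_zero_iff_dvd _ _).mp ?_⟩
  push_cast at ht ⊢
  linear_combination -ht

theorem sum_three_sq_of_mod_four_eq_two (n : ℕ) (hn : n % 4 = 2) :
    ∃ u v w : ℤ, (n : ℤ) = u ^ 2 + v ^ 2 + w ^ 2 := by
  have hcop : (n - 1).Coprime (4 * n) := by
    refine Nat.Coprime.mul_right ?_ ?_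
    · exact Nat.Coprime.pow_right 2 (Nat.coprime_two_right.mpr (Nat.odd_iff.mpr (by omega)))
    · have := Nat.coprime_self_add_right (m := n - 1) (n := 1)
      rw [show n - 1 + 1 = n by omega] at this
      exact this.mpr (Nat.coprime_one_right _)
  obtain ⟨p, hgt, hp, hmod⟩ :=
    Nat.forall_exists_prime_gt_and_modEq n (q := 4 * n) (by omega) hcop
  obtain ⟨v, hv⟩ := (Nat.modEq_iff_dvd' (by omega)).mp hmod.symm
  obtain ⟨d, hd⟩ : ∃ d, d = 4 * v + 1 := ⟨_, rfl⟩
  have hpd : p + 1 = d * n := by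
    have : p + 1 = n + 4 * n * v := by omega
    rw [this, hd]; ring
  have hp4 : p % 4 = 1 := by
    have : p = n - 1 + 4 * (n * v) := by rw [← mul_assoc]; omega
    omega
  have hpZ : (p : ℤ) = d * n - 1 := by rw [eq_sub_iff_add_eq]; exact_mod_cast hpd
  have hdodd : Odd d := Nat.odd_iff.mpr (by omega)
  have hpodd : Odd p := Nat.odd_iff.mpr (by omega)
  have hJ : jacobiSym (-d) p = 1 := by
    rw [jacobiSym.neg _ hpodd, ZMod.χ₄_nat_one_mod_four hp4, one_mul,
      jacobiSym.quadratic_reciprocity_one_mod_four' hdodd hp4,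
      jacobiSym.mod_left' (a₂ := -1) (by rw [hpZ, sub_eq_add_neg, Int.mul_add_emod_self_left]),
      jacobiSym.at_neg_one hdodd, ZMod.χ₄_nat_one_mod_four (by omega)]
  obtain ⟨t, ht⟩ := exists_dvd_sq_add_of_jacobiSym_eq_one hp hJ
  exact sum_three_sq_of_dvd_sq_add n d t (by omega) (by omega) (hpZ ▸ ht)

/-- The odd case of the three squares theorem: `sum_three_sq_of_dvd_sq_add` applies to some
`d ≡ c` mod `8` for which `(d * n - 1) / 2` is prime. -/
theorem sum_three_sq_of_odd (n c : ℕ) (hn : 2 ≤ n)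
    (h : n % 8 = 3 ∧ c = 1 ∨ n % 8 = 1 ∧ c = 3 ∨ n % 8 = 5 ∧ c = 3) :
    ∃ u v w : ℤ, (n : ℤ) = u ^ 2 + v ^ 2 + w ^ 2 := by
  obtain ⟨r, hr⟩ : ∃ r, 2 * r + 1 = c * n := ⟨(c * n - 1) / 2, by
    rcases h with ⟨h, rfl⟩ | ⟨h, rfl⟩ | ⟨h, rfl⟩ <;> omega⟩
  have hr4 : n % 8 = 3 ∧ c = 1 ∧ r % 4 = 1 ∨ n % 8 = 1 ∧ c = 3 ∧ r % 4 = 1 ∨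
      n % 8 = 5 ∧ c = 3 ∧ r % 4 = 3 := by
    rcases h with ⟨h, rfl⟩ | ⟨h, rfl⟩ | ⟨h, rfl⟩ <;> omega
  have hcop : r.Coprime (4 * n) := by
    refine Nat.Coprime.mul_right ?_ ?_
    · exact Nat.Coprime.pow_right 2 (Nat.coprime_two_right.mpr (Nat.odd_iff.mpr (by omega)))
    · refine Nat.Coprime.coprime_dvd_right (Dvd.intro_left c hr.symm) ?_
      simp
  obtain ⟨p, hgt, hp, hmod⟩ :=
    Nat.forall_exists_prime_gt_and_modEq (r + 2) (q := 4 * n) (by omega) hcop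
  obtain ⟨v, hv⟩ := (Nat.modEq_iff_dvd' (by omega)).mp hmod.symm
  obtain ⟨d, hd⟩ : ∃ d, d = 8 * v + c := ⟨_, rfl⟩
  have hpd : 2 * p + 1 = d * n := by
    rw [hd]
    have : p = r + 4 * n * v := by omega
    rw [this]; linear_combination hr
  have hpr : p % 4 = r % 4 := by
    have : p = r + 4 * (n * v) := by rw [← mul_assoc]; omega
    omega
  have hpZ : (2 * p : ℤ) = d * n - 1 := by rw [eq_sub_iff_add_eq]; exact_mod_cast hpd
  have hdodd : Odd d := Nat.odd_iff.mpr (by omega)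
  have hpodd : Odd p := Nat.odd_iff.mpr (by omega)
  have hJ2 : jacobiSym 2 d * jacobiSym p d = jacobiSym (-1) d := by
    rw [← jacobiSym.mul_left, hpZ]
    exact jacobiSym.mod_left' (by rw [sub_eq_add_neg, Int.mul_add_emod_self_left])
  rw [jacobiSym.at_two hdodd, jacobiSym.at_neg_one hdodd] at hJ2
  have hJ : jacobiSym (-d) p = 1 := by
    rw [jacobiSym.neg _ hpodd]
    rcases hr4 with ⟨-, rfl, hr4⟩ | ⟨-, rfl, hr4⟩ | ⟨-, rfl, hr4⟩
    · rw [ZMod.χ₄_nat_one_mod_four (by omega),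
        jacobiSym.quadratic_reciprocity_one_mod_four' hdodd (by omega)]
      rw [ZMod.χ₄_nat_one_mod_four (by omega), ZMod.χ₈_nat_eq_if_mod_eight] at hJ2
      simpa [show d % 8 = 1 by omega, show d % 2 = 1 by omega] using hJ2
    · rw [ZMod.χ₄_nat_one_mod_four (by omega),
        jacobiSym.quadratic_reciprocity_one_mod_four' hdodd (by omega)]
      rw [ZMod.χ₄_nat_three_mod_four (by omega), ZMod.χ₈_nat_eq_if_mod_eight] at hJ2
      simpa [show d % 8 = 3 by omega, show d % 2 = 1 by omega] using hJ2
    · rw [ZMod.χ₄_nat_three_mod_four (by omega),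
        jacobiSym.quadratic_reciprocity_three_mod_four (by omega) (by omega)]
      rw [ZMod.χ₄_nat_three_mod_four (by omega), ZMod.χ₈_nat_eq_if_mod_eight] at hJ2
      simpa [show d % 8 = 3 by omega, show d % 2 = 1 by omega] using hJ2
  obtain ⟨t, ht⟩ := exists_dvd_sq_add_of_jacobiSym_eq_one hp hJ
  obtain ⟨t, hodd, ht⟩ : ∃ t : ℤ, t % 2 = 1 ∧ (p : ℤ) ∣ t ^ 2 + d := by
    rcases Int.emod_two_eq_zero_or_one t with h₀ | h₁
    · refine ⟨t + p, by omega, ?_⟩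
      rw [show (t + p) ^ 2 + (d : ℤ) = t ^ 2 + d + p * (2 * t + p) by ring]
      exact ht.add (dvd_mul_right _ _)
    · exact ⟨t, h₁, ht⟩
  refine sum_three_sq_of_dvd_sq_add n d t (by omega) (by omega) (hpZ ▸ ?_)
  refine IsCoprime.mul_dvd ?_ ?_ ht
  · exact_mod_cast Nat.isCoprime_iff_coprime.mpr (Nat.coprime_two_left.mpr hpodd)
  · have : t ^ 2 % 2 = 1 := by rw [pow_two, Int.mul_emod, hodd]; rfl
    omega

theorem sum_three_sq_of_forall_ne (n : ℕ) (hn : ∀ k l : ℕ, n ≠ 4 ^ k * (8 * l + 7)) :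
    ∃ u v w : ℤ, (n : ℤ) = u ^ 2 + v ^ 2 + w ^ 2 := by
  induction n using Nat.strong_induction_on with
  | _ n ih =>
    rcases lt_or_ge n 2 with h₂ | h₂
    · interval_cases n
      · exact ⟨0, 0, 0, by norm_num⟩
      · exact ⟨1, 0, 0, by norm_num⟩
    by_cases h₄ : n % 4 = 0
    · obtain ⟨m, rfl⟩ := Nat.dvd_of_mod_eq_zero h₄
      obtain ⟨u, v, w, h⟩ := ih m (by omega) fun k l hkl ↦
        hn (k + 1) l (by rw [hkl]; ring)
      exact ⟨2 * u, 2 * v, 2 * w, by push_cast; linear_combination 4 * h⟩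
    by_cases h₂' : n % 4 = 2
    · exact sum_three_sq_of_mod_four_eq_two n h₂'
    have h₇ : n % 8 ≠ 7 := fun h ↦ hn 0 (n / 8) (by omega)
    by_cases h₃ : n % 8 = 3
    · exact sum_three_sq_of_odd n 1 h₂ (.inl ⟨h₃, rfl⟩)
    · exact sum_three_sq_of_odd n 3 h₂ (by omega)

theorem sum_three_sq_ne (k l : ℕ) (u v w : ℤ) :
    u ^ 2 + v ^ 2 + w ^ 2 ≠ 4 ^ k * (8 * l + 7) := by
  induction k generalizing u v w with
  | zero =>
    intro h
    have hsq (x : ℤ) : x ^ 2 % 8 = 0 ∨ x ^ 2 % 8 = 1 ∨ x ^ 2 % 8 = 4 := by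
      have : x % 8 = 0 ∨ x % 8 = 1 ∨ x % 8 = 2 ∨ x % 8 = 3 ∨ x % 8 = 4 ∨ x % 8 = 5 ∨
        x % 8 = 6 ∨ x % 8 = 7 := by omega
      rcases this with h | h | h | h | h | h | h | h <;> simp [pow_two, Int.mul_emod, h]
    have hu := hsq u
    have hv := hsq v
    have hw := hsq w
    omega
  | succ k ih =>
    intro h
    rw [pow_succ' 4, mul_assoc] at h
    have hsq (x : ℤ) : x % 2 = 0 ∧ x ^ 2 % 4 = 0 ∨ x ^ 2 % 4 = 1 := by
      have : x % 4 = 0 ∨ x % 4 = 1 ∨ x % 4 = 2 ∨ x % 4 = 3 := by omega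
      rcases this with h | h | h | h <;> simp [pow_two, Int.mul_emod, h] <;> omega
    have hu := hsq u
    have hv := hsq v
    have hw := hsq w
    obtain ⟨a, rfl⟩ : (2 : ℤ) ∣ u := by omega
    obtain ⟨b, rfl⟩ : (2 : ℤ) ∣ v := by omega
    obtain ⟨c, rfl⟩ : (2 : ℤ) ∣ w := by omega
    exact ih a b c (by linarith)

/-- If `6m` is a sum of three squares, their roots can be permuted and given signs so that all
three agree mod `3` and two of them agree mod `2`; the form then represents `m`. -/
theorem exists_rep_of_sum_three_sq (m u v w : ℤ) (h : 6 * m = u ^ 2 + v ^ 2 + w ^ 2) :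
    ∃ x y z : ℤ, x ^ 2 + 2 * y ^ 2 + 3 * z ^ 2 = m := by
  have hsign : ∃ a b c : ℤ, a % 3 = b % 3 ∧ b % 3 = c % 3 ∧
      6 * m = a ^ 2 + b ^ 2 + c ^ 2 := by
    have hsq (x : ℤ) : ∃ a : ℤ, a ^ 2 = x ^ 2 ∧
        (a % 3 = 0 ∧ a ^ 2 % 3 = 0 ∨ a % 3 = 1 ∧ a ^ 2 % 3 = 1) := by
      have : x % 3 = 0 ∨ x % 3 = 1 ∨ -x % 3 = 1 := by omega
      rcases this with h | h | h
      · exact ⟨x, rfl, .inl ⟨h, by simp [pow_two, Int.mul_emod, h]⟩⟩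
      · exact ⟨x, rfl, .inr ⟨h, by simp [pow_two, Int.mul_emod, h]⟩⟩
      · exact ⟨-x, by ring, .inr ⟨h, by rw [pow_two, Int.mul_emod, h]; rfl⟩⟩
    obtain ⟨a, ha, ha'⟩ := hsq u
    obtain ⟨b, hb, hb'⟩ := hsq v
    obtain ⟨c, hc, hc'⟩ := hsq w
    exact ⟨a, b, c, by omega, by omega, by linarith⟩
  obtain ⟨a, b, c, hab, hbc, h⟩ : ∃ a b c : ℤ, a % 6 = b % 6 ∧ b % 3 = c % 3 ∧
      6 * m = a ^ 2 + b ^ 2 + c ^ 2 := by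
    obtain ⟨a, b, c, hab, hbc, h⟩ := hsign
    have : a % 2 = b % 2 ∨ b % 2 = c % 2 ∨ a % 2 = c % 2 := by omega
    rcases this with h₂ | h₂ | h₂
    · exact ⟨a, b, c, by omega, hbc, h⟩
    · exact ⟨b, c, a, by omega, by omega, by linarith⟩
    · exact ⟨a, c, b, by omega, by omega, by linarith⟩
  have hc : c % 2 = 0 := by
    have hsq (x : ℤ) : x ^ 2 % 2 = x % 2 := by
      rcases Int.emod_two_eq_zero_or_one x with h | h <;> simp [pow_two, Int.mul_emod, h]
    have ha := hsq a
    have hb := hsq b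
    have hc := hsq c
    omega
  obtain ⟨z, hz⟩ : (6 : ℤ) ∣ a - b := by omega
  obtain ⟨y, hy⟩ : (6 : ℤ) ∣ a + b + c := by omega
  obtain ⟨x, hx⟩ : (6 : ℤ) ∣ a + b - 2 * c := by omega
  obtain rfl : a = x + 2 * y + 3 * z := by omega
  obtain rfl : b = x + 2 * y - 3 * z := by omega
  obtain rfl : c = 2 * y - 2 * x := by omega
  exact ⟨x, y, z, by linarith⟩

theorem rep_x2_2y2_3z2 (m : ℤ) (hm : 0 < m) :
    (∃ x y z : ℤ, x ^ 2 + 2 * y ^ 2 + 3 * z ^ 2 = m) ↔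
      ¬ ∃ k l : ℕ, m = 4 ^ k * (16 * l + 10) := by
  constructor
  · rintro ⟨x, y, z, rfl⟩ ⟨k, l, h⟩
    refine sum_three_sq_ne (k + 1) (3 * l + 1) (x + 2 * y + 3 * z) (x + 2 * y - 3 * z)
      (2 * y - 2 * x) ?_
    push_cast
    linear_combination 6 * h
  · intro h
    lift m to ℕ using hm.le
    obtain ⟨u, v, w, huvw⟩ := sum_three_sq_of_forall_ne (6 * m) fun k l hkl ↦ by
      rcases k with _ | k
      · omega
      have h3 : 3 ∣ 4 ^ k * (8 * l + 7) := by
        rw [pow_succ', mul_assoc] at hkl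
        omega
      have h3' : 3 ∣ 8 * l + 7 :=
        (Nat.Coprime.pow_right k (by norm_num : Nat.Coprime 3 4)).dvd_of_dvd_mul_left h3
      obtain ⟨j, rfl⟩ : ∃ j, l = 3 * j + 1 := ⟨l / 3, by omega⟩
      refine h ⟨k, j, ?_⟩
      have : m = 4 ^ k * (16 * j + 10) := by
        rw [pow_succ] at hkl
        linarith
      exact_mod_cast this
    exact exists_rep_of_sum_three_sq m u v w (by exact_mod_cast huvw)
end

section
/- A positive integer m is represented by the quadratic form x^2 + 2y^2 + 2yz + 3z^2 (i.e., there exist integers x, y, z with x^2 + 2y^2 + 2yz + 3z^2 = m) if and only if m is not of the form 25^k(25ℓ + 5) and not of the form 25^k(25ℓ - 5) for any nonnegative integers k and ℓ. -/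
/-- The integral ternary quadratic form `a x² + b y² + c z² + 2 d yz + 2 e xz + 2 f xy`. -/
structure TernaryForm where
  (a b c d e f : ℤ)

namespace TernaryForm

/-- The value of the form at `(x, y, z)`. -/
def eval (F : TernaryForm) (x y z : ℤ) : ℤ :=
  F.a * x ^ 2 + F.b * y ^ 2 + F.c * z ^ 2 + 2 * F.d * y * z + 2 * F.e * x * z + 2 * F.f * x * y

/-- The symmetric bilinear form with `bilin v v = eval v`. -/
def bilin (F : TernaryForm) (x y z x' y' z' : ℤ) : ℤ :=
  F.a * x * x' + F.b * y * y' + F.c * z * z' + F.d * (y * z' + z * y') +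
    F.e * (x * z' + z * x') + F.f * (x * y' + y * x')

/-- The determinant of the Gram matrix. -/
def det (F : TernaryForm) : ℤ :=
  F.a * F.b * F.c + 2 * F.d * F.e * F.f - F.a * F.d ^ 2 - F.b * F.e ^ 2 - F.c * F.f ^ 2

/-- The leading `2 × 2` minor of the Gram matrix. -/
def minor (F : TernaryForm) : ℤ := F.a * F.b - F.f ^ 2

/-- `F` takes the value `m`, and some pair of vectors has Gram determinant `n`. -/
def Represents (F : TernaryForm) (m n : ℤ) : Prop :=
  (∃ x y z, F.eval x y z = m) ∧
    ∃ x y z x' y' z',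
      F.eval x y z * F.eval x' y' z' - F.bilin x y z x' y' z' ^ 2 = n

/-- Substitute `x + k y` for `x`. -/
def shearXY (F : TernaryForm) (k : ℤ) : TernaryForm :=
  ⟨F.a, F.b + 2 * k * F.f + k ^ 2 * F.a, F.c, F.d + k * F.e, F.e, F.f + k * F.a⟩

/-- Substitute `x + k z` for `x`. -/
def shearXZ (F : TernaryForm) (k : ℤ) : TernaryForm :=
  ⟨F.a, F.b, F.c + 2 * k * F.e + k ^ 2 * F.a, F.d + k * F.f, F.e + k * F.a, F.f⟩

/-- Substitute `y + k z` for `y`. -/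
def shearYZ (F : TernaryForm) (k : ℤ) : TernaryForm :=
  ⟨F.a, F.b, F.c + 2 * k * F.d + k ^ 2 * F.b, F.d + k * F.b, F.e + k * F.f, F.f⟩

/-- Exchange `x` and `y`. -/
def swapXY (F : TernaryForm) : TernaryForm := ⟨F.b, F.a, F.c, F.e, F.d, F.f⟩

/-- Exchange `y` and `z`. -/
def swapYZ (F : TernaryForm) : TernaryForm := ⟨F.a, F.c, F.b, F.d, F.f, F.e⟩

/-- Positive definite forms of determinant `5` with the representation property `Represents m n`. -/
structure Admissible (m n : ℤ) (F : TernaryForm) : Prop where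
  rep : F.Represents m n
  a_pos : 0 < F.a
  minor_pos : 0 < F.minor
  det_eq : F.det = 5

variable {F : TernaryForm} {m n : ℤ}

namespace Admissible

theorem shearXY (h : F.Admissible m n) (k : ℤ) : (F.shearXY k).Admissible m n := by
  obtain ⟨⟨⟨x, y, z, h1⟩, x₁, y₁, z₁, x₂, y₂, z₂, h2⟩, ha, hA, hd⟩ := h
  refine ⟨⟨⟨x - k * y, y, z, ?_⟩, x₁ - k * y₁, y₁, z₁, x₂ - k * y₂, y₂, z₂, ?_⟩, ha, ?_, ?_⟩
  · rw [← h1]; simp only [eval, TernaryForm.shearXY]; ring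
  · rw [← h2]; simp only [eval, bilin, TernaryForm.shearXY]; ring
  · refine hA.trans_eq ?_; simp only [minor, TernaryForm.shearXY]; ring
  · rw [← hd]; simp only [det, TernaryForm.shearXY]; ring

theorem shearXZ (h : F.Admissible m n) (k : ℤ) : (F.shearXZ k).Admissible m n := by
  obtain ⟨⟨⟨x, y, z, h1⟩, x₁, y₁, z₁, x₂, y₂, z₂, h2⟩, ha, hA, hd⟩ := h
  refine ⟨⟨⟨x - k * z, y, z, ?_⟩, x₁ - k * z₁, y₁, z₁, x₂ - k * z₂, y₂, z₂, ?_⟩, ha, hA, ?_⟩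
  · rw [← h1]; simp only [eval, TernaryForm.shearXZ]; ring
  · rw [← h2]; simp only [eval, bilin, TernaryForm.shearXZ]; ring
  · rw [← hd]; simp only [det, TernaryForm.shearXZ]; ring

theorem shearYZ (h : F.Admissible m n) (k : ℤ) : (F.shearYZ k).Admissible m n := by
  obtain ⟨⟨⟨x, y, z, h1⟩, x₁, y₁, z₁, x₂, y₂, z₂, h2⟩, ha, hA, hd⟩ := h
  refine ⟨⟨⟨x, y - k * z, z, ?_⟩, x₁, y₁ - k * z₁, z₁, x₂, y₂ - k * z₂, z₂, ?_⟩, ha, hA, ?_⟩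
  · rw [← h1]; simp only [eval, TernaryForm.shearYZ]; ring
  · rw [← h2]; simp only [eval, bilin, TernaryForm.shearYZ]; ring
  · rw [← hd]; simp only [det, TernaryForm.shearYZ]; ring

theorem swapXY (h : F.Admissible m n) : F.swapXY.Admissible m n := by
  obtain ⟨⟨⟨x, y, z, h1⟩, x₁, y₁, z₁, x₂, y₂, z₂, h2⟩, ha, hA, hd⟩ := h
  refine ⟨⟨⟨y, x, z, ?_⟩, y₁, x₁, z₁, y₂, x₂, z₂, ?_⟩, ?_, ?_, ?_⟩
  · rw [← h1]; simp only [eval, TernaryForm.swapXY]; ring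
  · rw [← h2]; simp only [eval, bilin, TernaryForm.swapXY]; ring
  · simp only [minor, TernaryForm.swapXY] at *; nlinarith [sq_nonneg F.f]
  · refine hA.trans_eq ?_; simp only [minor, TernaryForm.swapXY]; ring
  · rw [← hd]; simp only [det, TernaryForm.swapXY]; ring

theorem minor_mul_sub_sq (h : F.Admissible m n) :
    F.minor * (F.a * F.c - F.e ^ 2) - (F.a * F.d - F.e * F.f) ^ 2 = 5 * F.a := by
  rw [← h.det_eq]; simp only [det, minor]; ring

theorem swapYZ (h : F.Admissible m n) : F.swapYZ.Admissible m n := by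
  have hmul := h.minor_mul_sub_sq
  obtain ⟨⟨⟨x, y, z, h1⟩, x₁, y₁, z₁, x₂, y₂, z₂, h2⟩, ha, hA, hd⟩ := h
  refine ⟨⟨⟨x, z, y, ?_⟩, x₁, z₁, y₁, x₂, z₂, y₂, ?_⟩, ha, ?_, ?_⟩
  · rw [← h1]; simp only [eval, TernaryForm.swapYZ]; ring
  · rw [← h2]; simp only [eval, bilin, TernaryForm.swapYZ]; ring
  · simp only [minor, TernaryForm.swapYZ] at *
    nlinarith [sq_nonneg (F.a * F.d - F.e * F.f)]
  · rw [← hd]; simp only [det, TernaryForm.swapYZ]; ring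

end Admissible

theorem exists_shift_abs_le {a : ℤ} (ha : 0 < a) (f : ℤ) : ∃ k, -a ≤ 2 * (f + k * a) ∧
    2 * (f + k * a) ≤ a := by
  refine ⟨-((2 * f + a) / (2 * a)), ?_⟩
  have h1 := Int.emod_nonneg (2 * f + a) (b := 2 * a) (by omega)
  have h2 := Int.emod_lt_of_pos (2 * f + a) (b := 2 * a) (by omega)
  have h3 := Int.emod_add_mul_ediv (2 * f + a) (2 * a)
  constructor <;> linarith

/-- An admissible form minimizing first `a` and then the leading minor. -/
theorem Admissible.exists_minimal (h : F.Admissible m n) :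
    ∃ G : TernaryForm, G.Admissible m n ∧ (∀ H : TernaryForm, H.Admissible m n → G.a ≤ H.a) ∧
      ∀ H : TernaryForm, H.Admissible m n → H.a = G.a → G.minor ≤ H.minor := by
  obtain ⟨G, hG, hmin⟩ := (measure fun H : TernaryForm => H.a.toNat).wf.has_min
    {H | H.Admissible m n} ⟨F, h⟩
  obtain ⟨G', ⟨hG', haG⟩, hmin'⟩ := (measure fun H : TernaryForm => H.minor.toNat).wf.has_min
    {H | H.Admissible m n ∧ H.a = G.a} ⟨G, hG, rfl⟩
  refine ⟨G', hG', fun H hH => ?_, fun H hH ha => ?_⟩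
  · have h1 : ¬ H.a.toNat < G.a.toNat := hmin H hH
    have := hH.a_pos
    omega
  · have h1 : ¬ H.minor.toNat < G'.minor.toNat := hmin' H ⟨hH, ha.trans haG⟩
    have := hH.minor_pos
    omega

/-- Reduction theory: every admissible form is equivalent to one satisfying Gauss's bounds. -/
theorem Admissible.exists_reduced (h : F.Admissible m n) :
    ∃ G : TernaryForm, G.Admissible m n ∧ G.a ≤ G.b ∧ G.minor ≤ G.a * G.c - G.e ^ 2 ∧
      |2 * G.f| ≤ G.a ∧ |2 * G.e| ≤ G.a ∧ |2 * (G.a * G.d - G.e * G.f)| ≤ G.minor := by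
  obtain ⟨G, hG, hmin, hmin'⟩ := h.exists_minimal
  obtain ⟨k, hk⟩ := exists_shift_abs_le hG.minor_pos (G.a * G.d - G.e * G.f)
  obtain ⟨l, hl⟩ := exists_shift_abs_le hG.a_pos G.f
  obtain ⟨r, hr⟩ := exists_shift_abs_le hG.a_pos (G.e + k * G.f)
  let H := ((G.shearYZ k).shearXZ r).shearXY l
  have hH : H.Admissible m n := ((hG.shearYZ k).shearXZ r).shearXY l
  have ha : H.a = G.a := rfl
  have hm : H.minor = G.minor := by
    simp only [H, minor, TernaryForm.shearXY, TernaryForm.shearXZ, TernaryForm.shearYZ]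
    ring
  have hB : H.a * H.d - H.e * H.f = G.a * G.d - G.e * G.f + k * G.minor := by
    simp only [H, minor, TernaryForm.shearXY, TernaryForm.shearXZ, TernaryForm.shearYZ]
    ring
  refine ⟨H, hH, ha.trans_le (hmin _ hH.swapXY), hm.trans_le (hmin' _ hH.swapYZ ha), ?_, ?_, ?_⟩
  · exact abs_le.2 hl
  · exact abs_le.2 hr
  · rw [hB, hm]; exact abs_le.2 hk

/-- Up to equivalence and the sign of `d`, there are two positive definite forms of
determinant `5`. -/
theorem Admissible.classification (h : F.Admissible m n) :
    (⟨1, 1, 5, 0, 0, 0⟩ : TernaryForm).Admissible m n ∨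
      ∃ d, d ^ 2 = 1 ∧ (⟨1, 2, 3, d, 0, 0⟩ : TernaryForm).Admissible m n := by
  obtain ⟨G, hG, hab, hAC, hf, he, hB⟩ := h.exists_reduced
  have hmul := hG.minor_mul_sub_sq
  have ha := hG.a_pos
  have hA := hG.minor_pos
  obtain ⟨a, b, c, d, e, f⟩ := G
  simp only at *
  have hA' : (⟨a, b, c, d, e, f⟩ : TernaryForm).minor = a * b - f ^ 2 := rfl
  generalize (⟨a, b, c, d, e, f⟩ : TernaryForm).minor = A at *
  have hAsq : 3 * A ^ 2 ≤ 20 * a := by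
    have := sq_le_sq' (abs_le.1 hB).1 (abs_le.1 hB).2
    nlinarith [mul_le_mul_of_nonneg_left hAC hA.le]
  have haA : 3 * a ^ 2 ≤ 4 * A := by
    have := sq_le_sq' (abs_le.1 hf).1 (abs_le.1 hf).2
    nlinarith [mul_le_mul_of_nonneg_left hab ha.le]
  have ha3 : a ≤ 2 := by
    by_contra! h3
    have h9 : 9 * a ≤ 4 * A := by nlinarith
    nlinarith
  rw [abs_le] at hf he hB
  have hA3 : A ≤ 3 := by nlinarith
  interval_cases a
  · obtain rfl : f = 0 := by omega
    obtain rfl : e = 0 := by omega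
    have hb : b = A := by linarith
    subst hb
    interval_cases b
    · obtain rfl : d = 0 := by omega
      obtain rfl : c = 5 := by linarith
      exact .inl hG
    · right
      have hd : d = -1 ∨ d = 0 ∨ d = 1 := by omega
      obtain rfl | rfl | rfl := hd
      · obtain rfl : c = 3 := by linarith
        exact ⟨-1, by norm_num, hG⟩
      · omega
      · obtain rfl : c = 3 := by linarith
        exact ⟨1, by norm_num, hG⟩
    · omega
  · obtain rfl : A = 3 := by omega
    generalize 2 * d - e * f = B at *
    have hB' : B = -1 ∨ B = 0 ∨ B = 1 := by omega
    obtain rfl | rfl | rfl := hB' <;> omega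

/-- The residue of `n` mod `5` rules out the class of `x² + y² + 5z²`. -/
theorem Admissible.exists_eq (h : F.Admissible m n) (hn : n % 5 = 2 ∨ n % 5 = 3) :
    ∃ x y z : ℤ, x ^ 2 + 2 * y ^ 2 + 2 * y * z + 3 * z ^ 2 = m := by
  obtain h | ⟨d, hd, h⟩ := h.classification
  · obtain ⟨x, y, z, x', y', z', rfl⟩ := h.rep.2
    have hsq : (⟨1, 1, 5, 0, 0, 0⟩ : TernaryForm).eval x y z *
        (⟨1, 1, 5, 0, 0, 0⟩ : TernaryForm).eval x' y' z' -
          (⟨1, 1, 5, 0, 0, 0⟩ : TernaryForm).bilin x y z x' y' z' ^ 2 =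
        (x * y' - y * x') ^ 2 + 5 * ((x * z' - z * x') ^ 2 + (y * z' - z * y') ^ 2) := by
      simp only [eval, bilin]; ring
    rw [hsq, Int.add_mul_emod_self_left, sq, Int.mul_emod] at hn
    have := Int.emod_nonneg (x * y' - y * x') (b := 5) (by norm_num)
    have := Int.emod_lt_of_pos (x * y' - y * x') (b := 5) (by norm_num)
    generalize (x * y' - y * x') % 5 = u at *
    interval_cases u <;> omega
  · obtain ⟨x, y, z, rfl⟩ := h.rep.1
    refine ⟨x, y, d * z, ?_⟩
    simp only [eval]
    linear_combination 3 * z ^ 2 * hd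

end TernaryForm

open TernaryForm in
/-- If `-c` is a square modulo `p`, then `m` occurs as a diagonal entry of a positive definite
Gram matrix of determinant `5` having `4c` as a minor. -/
theorem exists_eq_of_dvd_sq_add {m t c p s : ℤ} (hc : 0 < c) (hp : 0 < p)
    (hc5 : c % 5 = 2 ∨ c % 5 = 3) (hs : p ∣ s ^ 2 + c) (hdet : 4 * m * c = t ^ 2 * p + 5) :
    ∃ x y z : ℤ, x ^ 2 + 2 * y ^ 2 + 2 * y * z + 3 * z ^ 2 = m := by
  obtain ⟨k, hk⟩ := hs
  have hk0 : 0 < k := pos_of_mul_pos_right (hk ▸ by positivity) hp.le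
  have hF : (⟨4 * k, p, m, 0, t, 2 * s⟩ : TernaryForm).Admissible m (4 * c) := by
    refine ⟨⟨⟨0, 0, 1, ?_⟩, 1, 0, 0, 0, 1, 0, ?_⟩, ?_, ?_, ?_⟩
    · simp [eval]
    · simp only [eval, bilin]; linear_combination -4 * hk
    · simpa using hk0
    · simp only [minor]; linarith
    · simp only [det]; linear_combination hdet - 4 * m * hk
  exact hF.exists_eq (by omega)

theorem jacobiSym_five_eq_neg_one {c : ℕ} (hc4 : c % 4 = 1) (hc5 : c % 5 = 2 ∨ c % 5 = 3) :
    jacobiSym 5 c = -1 := by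
  have h := jacobiSym.quadratic_reciprocity_one_mod_four (a := 5) (b := c) (by norm_num)
    (Nat.odd_iff.2 (by omega))
  rw [show (5 : ℤ) = ((5 : ℕ) : ℤ) by norm_num, h, jacobiSym.mod_left]
  obtain h5 | h5 := hc5
  · rw [show ((c : ℤ) % ((5 : ℕ) : ℤ)) = 2 by omega]; norm_num
  · rw [show ((c : ℤ) % ((5 : ℕ) : ℤ)) = 3 by omega]; norm_num

theorem exists_dvd_sq_add {c p : ℕ} (hp : p.Prime) (hp4 : p % 4 = 3) (hc4 : c % 4 = 1)
    (h : jacobiSym p c = -1) : ∃ s : ℤ, (p : ℤ) ∣ s ^ 2 + c := by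
  have := Fact.mk hp
  have hodd : Odd p := Nat.odd_iff.2 (by omega)
  have h1 : legendreSym p (-c : ℤ) = 1 := by
    rw [jacobiSym.legendreSym.to_jacobiSym, jacobiSym.neg _ hodd,
      ZMod.χ₄_nat_three_mod_four hp4, jacobiSym.quadratic_reciprocity_one_mod_four hc4 hodd, h]
    norm_num
  have h0 : ((-c : ℤ) : ZMod p) ≠ 0 := by
    intro h0
    rw [(legendreSym.eq_zero_iff p _).2 h0] at h1
    exact zero_ne_one h1
  obtain ⟨r, hr⟩ := (legendreSym.eq_one_iff p h0).1 h1
  obtain ⟨s, rfl⟩ := ZMod.intCast_surjective r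
  refine ⟨s, (ZMod.intCast_zmod_eq_zero_iff_dvd _ p).1 ?_⟩
  push_cast at hr ⊢
  linear_combination -hr

theorem int_prime_five : Prime (5 : ℤ) := Int.prime_iff_natAbs_prime.2 (by norm_num)

theorem exists_prime_eq_add_mul {a q : ℤ} (hq : 0 < q) (h : IsCoprime a q) :
    ∃ p j : ℕ, p.Prime ∧ (p : ℤ) = a + q * j := by
  lift q to ℕ using hq.le
  obtain ⟨p, hgt, hp, hmod⟩ :=
    Nat.forall_exists_prime_gt_and_zmodEq a.toNat (by omega : q ≠ 0) h
  obtain ⟨j, hj⟩ := hmod.symm.dvd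
  have hj0 : 0 < j := pos_of_mul_pos_right (hj ▸ by omega) hq.le
  lift j to ℕ using hj0.le
  exact ⟨p, j, hp, by linarith⟩

theorem exists_eq_of_not_five_dvd {m : ℤ} (hm : 0 < m) (h5 : ¬ 5 ∣ m) :
    ∃ x y z : ℤ, x ^ 2 + 2 * y ^ 2 + 2 * y * z + 3 * z ^ 2 = m := by
  have hm5 : IsCoprime 5 m := int_prime_five.coprime_iff_not_dvd.2 h5
  have hcop : IsCoprime (68 * m - 5) (80 * m) := by
    have h1 : IsCoprime (68 * m - 5) m := by
      obtain ⟨u, v, huv⟩ := hm5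
      exact ⟨-u, v + 68 * u, by linear_combination huv⟩
    have h2 : IsCoprime (68 * m - 5) (4 ^ 2) := IsCoprime.pow_right ⟨-1, 17 * m - 1, by ring⟩
    have h3 : IsCoprime (68 * m - 5) 5 := by
      obtain ⟨u, v, huv⟩ := hm5
      exact ⟨2 * v, u - 27 * m * v + 2 * v, by linear_combination huv⟩
    convert (h2.mul_right h3).mul_right h1 using 1
    norm_num
  obtain ⟨p, j, hp, hpj⟩ := exists_prime_eq_add_mul (by omega) hcop
  obtain ⟨c, hc⟩ : ∃ c : ℕ, c = 17 + 20 * j := ⟨_, rfl⟩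
  have hpc : (p : ℤ) = 4 * m * c - 5 := by rw [hpj, hc]; push_cast; ring
  have hp4 : p % 4 = 3 := by
    rw [mul_assoc] at hpc
    omega
  have hjac : jacobiSym p c = -1 := by
    have hcong : (p : ℤ) % c = -1 * 5 % c :=
      Int.ModEq.symm (Int.modEq_iff_dvd.2 ⟨4 * m, by linarith⟩)
    rw [jacobiSym.mod_left' hcong, jacobiSym.mul_left,
      jacobiSym_five_eq_neg_one (by omega) (by omega),
      jacobiSym.at_neg_one (Nat.odd_iff.2 (by omega)), ZMod.χ₄_nat_one_mod_four (by omega)]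
    norm_num
  obtain ⟨s, hs⟩ := exists_dvd_sq_add hp hp4 (by omega) hjac
  exact exists_eq_of_dvd_sq_add (t := 1) (by omega) (by exact_mod_cast hp.pos) (by omega) hs
    (by linarith)

theorem exists_eq_five_mul {m : ℤ} (hm : 0 < m) (h5 : m % 5 = 2 ∨ m % 5 = 3) :
    ∃ x y z : ℤ, x ^ 2 + 2 * y ^ 2 + 2 * y * z + 3 * z ^ 2 = 5 * m := by
  obtain ⟨c₀, p₀, hc₀, hp₀⟩ : ∃ (c₀ : ℕ) (p₀ : ℤ), (c₀ = 17 ∨ c₀ = 13) ∧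
      5 * p₀ + 1 = 4 * m * c₀ := by
    obtain h5 | h5 := h5
    · exact ⟨17, (68 * m - 1) / 5, .inl rfl, by push_cast; omega⟩
    · exact ⟨13, (52 * m - 1) / 5, .inr rfl, by push_cast; omega⟩
  have hcop : IsCoprime p₀ (16 * m) := by
    have h1 : IsCoprime p₀ 4 := ⟨-5, m * c₀, by linear_combination -hp₀⟩
    have h2 : IsCoprime p₀ (4 * m) := ⟨-5, c₀, by linear_combination -hp₀⟩
    convert h1.mul_right h2 using 1
    ring
  obtain ⟨p, j, hp, hpj⟩ := exists_prime_eq_add_mul (by omega) hcop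
  obtain ⟨c, hc⟩ : ∃ c : ℕ, c = c₀ + 20 * j := ⟨_, rfl⟩
  have hpc : 5 * (p : ℤ) = 4 * m * c - 1 := by
    rw [hpj, hc]; push_cast; linear_combination hp₀
  have hp4 : p % 4 = 3 := by
    rw [mul_assoc] at hpc
    omega
  have hjac : jacobiSym p c = -1 := by
    have hcong : 5 * (p : ℤ) % c = -1 % c :=
      Int.ModEq.symm (Int.modEq_iff_dvd.2 ⟨4 * m, by linarith⟩)
    have h1 : jacobiSym (5 * p) c = 1 := by
      rw [jacobiSym.mod_left' hcong, jacobiSym.at_neg_one (Nat.odd_iff.2 (by omega)),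
        ZMod.χ₄_nat_one_mod_four (by omega)]
    rw [jacobiSym.mul_left, jacobiSym_five_eq_neg_one (by omega) (by omega)] at h1
    linarith
  obtain ⟨s, hs⟩ := exists_dvd_sq_add hp hp4 (by omega) hjac
  exact exists_eq_of_dvd_sq_add (t := 5) (by omega) (by exact_mod_cast hp.pos) (by omega) hs
    (by linarith)

theorem five_dvd_form {x y z : ℤ} (h : 5 ∣ x ^ 2 + 2 * y ^ 2 + 2 * y * z + 3 * z ^ 2) :
    5 ∣ x ∧ 5 ∣ y - 2 * z := by
  have key : ∀ x y z : ZMod 5, x ^ 2 + 2 * y ^ 2 + 2 * y * z + 3 * z ^ 2 = 0 →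
      x = 0 ∧ y - 2 * z = 0 := by decide
  have hx := key x y z (by exact_mod_cast (ZMod.intCast_zmod_eq_zero_iff_dvd _ 5).2 h)
  exact ⟨(ZMod.intCast_zmod_eq_zero_iff_dvd _ 5).1 hx.1,
    (ZMod.intCast_zmod_eq_zero_iff_dvd _ 5).1 (by exact_mod_cast hx.2)⟩

theorem form_ne_pow_mul (k : ℕ) {n : ℤ} (hn : n % 25 = 5 ∨ n % 25 = 20) (x y z : ℤ) :
    x ^ 2 + 2 * y ^ 2 + 2 * y * z + 3 * z ^ 2 ≠ 25 ^ k * n := by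
  induction k generalizing x y z with
  | zero =>
    intro h
    rw [pow_zero, one_mul] at h
    obtain ⟨⟨u, rfl⟩, v, hv⟩ := five_dvd_form (x := x) (y := y) (z := z) (by omega)
    obtain rfl : y = 2 * z + 5 * v := by linarith
    have hz : n = 25 * (u ^ 2 + 2 * v * z + 2 * v ^ 2) + 15 * z ^ 2 := by
      rw [← h]; ring
    have h5 : 3 * z ^ 2 % 5 = 1 ∨ 3 * z ^ 2 % 5 = 4 := by omega
    rw [sq, Int.mul_emod, Int.mul_emod z] at h5
    have := Int.emod_nonneg z (b := 5) (by norm_num)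
    have := Int.emod_lt_of_pos z (b := 5) (by norm_num)
    generalize z % 5 = w at *
    interval_cases w <;> omega
  | succ k ih =>
    intro h
    rw [pow_succ 25 k, mul_right_comm (25 ^ k)] at h
    obtain ⟨⟨u, rfl⟩, v, hv⟩ := five_dvd_form (x := x) (y := y) (z := z) (by omega)
    obtain rfl : y = 2 * z + 5 * v := by linarith
    have hz : 25 ^ k * n * 25 = 25 * (u ^ 2 + 2 * v * z + 2 * v ^ 2) + 15 * z ^ 2 := by
      rw [← h]; ring
    obtain ⟨w, rfl⟩ : 5 ∣ z := int_prime_five.dvd_of_dvd_pow (n := 2) (by omega)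
    exact ih u (2 * w + v) w (by linarith)

theorem exists_eq_of_forall_ne {m : ℤ} (hm : 0 < m)
    (h : ∀ (k : ℕ) (n : ℤ), n % 25 = 5 ∨ n % 25 = 20 → m ≠ 25 ^ k * n) :
    ∃ x y z : ℤ, x ^ 2 + 2 * y ^ 2 + 2 * y * z + 3 * z ^ 2 = m := by
  induction hN : m.toNat using Nat.strong_induction_on generalizing m with
  | _ N ih =>
    by_cases h5 : 5 ∣ m
    · obtain ⟨r, rfl⟩ := h5
      by_cases hr : 5 ∣ r
      · obtain ⟨t, rfl⟩ := hr
        obtain ⟨x, y, z, hxyz⟩ := @ih t.toNat (by omega) t (by omega)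
          (fun k n hn ht => h (k + 1) n hn (by rw [ht]; ring)) rfl
        exact ⟨5 * x, 5 * y, 5 * z, by rw [← hxyz]; ring⟩
      · have h0 := h 0 (5 * r)
        rw [pow_zero, one_mul] at h0
        exact exists_eq_five_mul (by omega) (by omega)
    · exact exists_eq_of_not_five_dvd hm h5

theorem rep_x2_2y2_2yz_3z2 (m : ℤ) (hm : 0 < m) :
    (∃ x y z : ℤ, x ^ 2 + 2 * y ^ 2 + 2 * y * z + 3 * z ^ 2 = m) ↔
      ((¬ ∃ k l : ℕ, m = 25 ^ k * (25 * l + 5)) ∧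
        ¬ ∃ k l : ℕ, m = 25 ^ k * (25 * l - 5)) := by
  constructor
  · rintro ⟨x, y, z, rfl⟩
    exact ⟨fun ⟨k, l, h⟩ => form_ne_pow_mul k (by omega) x y z h,
      fun ⟨k, l, h⟩ => form_ne_pow_mul k (by omega) x y z h⟩
  · rintro ⟨h1, h2⟩
    refine exists_eq_of_forall_ne hm fun k n hn hk => ?_
    have hn0 : 0 < n := pos_of_mul_pos_right (hk ▸ hm) (by positivity)
    obtain hn | hn := hn
    · exact h1 ⟨k, (n / 25).toNat, by rw [hk]; congr 1; omega⟩
    · exact h2 ⟨k, (n / 25 + 1).toNat, by rw [hk]; congr 1; omega⟩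
end
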